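/- Let n, m ≥ 2 with m odd or n odd. In the group S_{n×m} of E-preserving permutations of Fin n × Fin m, with products written left-to-right (αβ means 'first α, then β'), the following identities hold: π = (ξ1 ξ2^{2n-1})^{(m-1)n} (ξ1^{m+1} ξ2^{2n-1})^{(m-1)(n-1)} ξ1^m; ρ = (ξ1 ξ2^{2n-1})^{n-1} (ξ1^{m+1} ξ2^{2n-1})^{(m-2)(n-1)}; π̄ = ξ1^{2m-1} (ξ1 ξ2^{2n-1})^{n} (ξ1^{m+1} ξ2^{2n-1})^{(m-2)(n-1)}; ρ̄ = ξ1^{2m-1} (ξ1 ξ2^{2n-1})^{(m-1)n} (ξ1^{m+1} ξ2^{2n-1})^{(m-1)(n-1)} ξ1^{m+2}. -/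

import Mathlib

/-- The permutation `s̄` of `Fin m` (0-indexed): the cycle `(2 3 ⋯ m)` if both `m`
and `n` are even, and the cycle `(1 2 ⋯ m)` otherwise. -/
def sbar (n m : ℕ) (hm : 2 ≤ m) : Equiv.Perm (Fin m) :=
  if Even m ∧ Even n then
    (finRotate m).trans (Equiv.swap (⟨0, by omega⟩ : Fin m) ⟨1, by omega⟩)
  else finRotate m

/-- The permutation `ξ1` of `Fin n × Fin m` (all 0-indexed): it sends
`(i,1) ↦ ((0 1)i, s̄ 1)` and `(i,j) ↦ (i, s̄ j)` for `j ≠ 1`. -/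
def xi1 (n m : ℕ) (hn : 2 ≤ n) (hm : 2 ≤ m) : Equiv.Perm (Fin n × Fin m) :=
  (Equiv.prodComm (Fin n) (Fin m)).trans
    ((Equiv.prodShear (sbar n m hm)
        (fun j => if j = (⟨1, by omega⟩ : Fin m) then
            Equiv.swap (⟨0, by omega⟩ : Fin n) ⟨1, by omega⟩
          else Equiv.refl (Fin n))).trans
      (Equiv.prodComm (Fin m) (Fin n)))

/-- The permutation `ξ2` of `Fin n × Fin m` (all 0-indexed): it sends
`(i,0) ↦ ((0 1 ⋯ n-1)i, 1)`, `(i,1) ↦ (i,0)`, and fixes `(i,j)` for `j ≥ 2`. -/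
def xi2 (n m : ℕ) (hn : 2 ≤ n) (hm : 2 ≤ m) : Equiv.Perm (Fin n × Fin m) :=
  (Equiv.prodComm (Fin n) (Fin m)).trans
    ((Equiv.prodShear (Equiv.swap (⟨0, by omega⟩ : Fin m) ⟨1, by omega⟩)
        (fun j => if j = (⟨0, by omega⟩ : Fin m) then finRotate n else Equiv.refl (Fin n))).trans
      (Equiv.prodComm (Fin m) (Fin n)))
/-- `π`: the permutation of `Fin n × Fin m` swapping `(0,0)` and `(1,0)` (0-indexed). -/
def piP (n m : ℕ) (hn : 2 ≤ n) (hm : 2 ≤ m) : Equiv.Perm (Fin n × Fin m) :=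
  Equiv.swap ((⟨0, by omega⟩ : Fin n), (⟨0, by omega⟩ : Fin m))
    ((⟨1, by omega⟩ : Fin n), (⟨0, by omega⟩ : Fin m))

/-- `ρ`: the permutation sending `(i,0) ↦ ((0 1 ⋯ n-1)i, 0)` and fixing all `(i,j)`, `j ≠ 0`. -/
def rhoP (n m : ℕ) (hn : 2 ≤ n) (hm : 2 ≤ m) : Equiv.Perm (Fin n × Fin m) :=
  (Equiv.prodComm (Fin n) (Fin m)).trans
    ((Equiv.prodShear (Equiv.refl (Fin m))
        (fun j => if j = (⟨0, by omega⟩ : Fin m) then finRotate n else Equiv.refl (Fin n))).trans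
      (Equiv.prodComm (Fin m) (Fin n)))

/-- `π̄`: the permutation swapping `(i,0) ↔ (i,1)` for every `i` and fixing all other points. -/
def pibarP (n m : ℕ) (hn : 2 ≤ n) (hm : 2 ≤ m) : Equiv.Perm (Fin n × Fin m) :=
  Equiv.prodCongr (Equiv.refl (Fin n)) (Equiv.swap (⟨0, by omega⟩ : Fin m) ⟨1, by omega⟩)

/-- `ρ̄`: the permutation sending `(i,j) ↦ (i, (0 1 ⋯ m-1)j)`. -/
def rhobarP (n m : ℕ) : Equiv.Perm (Fin n × Fin m) :=
  Equiv.prodCongr (Equiv.refl (Fin n)) (finRotate m)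

open Equiv

/-- The word identities, in an abstract group: `P` and `R` play the role of permutations supported
on one column, and `d` that of a permutation fixing this column pointwise. -/
lemma words_eq_of_commute {G : Type*} [Group G] {P R d : G} {n m : ℕ} (hn : 2 ≤ n) (hm : 2 ≤ m)
    (hpar : Odd m ∨ Odd n) (hR : R ^ n = 1) (hRP : (R⁻¹ * P) ^ (n - 1) = 1)
    (hd : (d ^ (m - 1)) ^ 2 = 1) (hPd : Commute P d) (hRd : Commute R d) :
    P * d ^ (m - 1) * (R⁻¹ * d * (P * d ^ (m - 1))) ^ ((m - 1) * (n - 1)) *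
        (R⁻¹ * d) ^ ((m - 1) * n) = P ∧
      (R⁻¹ * d * (P * d ^ (m - 1))) ^ ((m - 2) * (n - 1)) * (R⁻¹ * d) ^ (n - 1) = R := by
  obtain ⟨n, rfl⟩ := Nat.exists_eq_add_of_le' hn
  obtain ⟨m, rfl⟩ := Nat.exists_eq_add_of_le' hm
  simp only [Nat.add_sub_cancel, show n + 2 - 1 = n + 1 by omega,
    show m + 2 - 1 = m + 1 by omega] at *
  have hcomm : Commute (R⁻¹ * P) (d ^ (m + 2)) := (hRd.inv_left.mul_left hPd).pow_right _
  have hb : R⁻¹ * d * (P * d ^ (m + 1)) = R⁻¹ * P * d ^ (m + 2) := by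
    rw [pow_succ' d (m + 1), mul_assoc, ← mul_assoc d P, ← hPd.eq]
    simp only [mul_assoc]
  have hb_pow (k : ℕ) : (R⁻¹ * d * (P * d ^ (m + 1))) ^ (k * (n + 1)) =
      d ^ ((m + 2) * (k * (n + 1))) := by
    rw [hb, hcomm.mul_pow, mul_comm k, pow_mul, hRP, one_pow, one_mul, ← pow_mul]
  have ha_pow (k : ℕ) : (R⁻¹ * d) ^ k = R⁻¹ ^ k * d ^ k := hRd.inv_left.mul_pow k
  have hd_even {k : ℕ} (hk : Even k) : d ^ ((m + 1) * k) = 1 := by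
    obtain ⟨l, rfl⟩ := hk
    rw [← two_mul, pow_mul, pow_mul, hd, one_pow]
  constructor
  · rw [hb_pow, ha_pow, mul_comm (m + 1) (n + 2), pow_mul R⁻¹, inv_pow, hR, inv_one, one_pow,
      one_mul, mul_assoc, mul_assoc, ← pow_add, ← pow_add]
    have : m + 1 + ((m + 2) * ((m + 1) * (n + 1)) + (n + 2) * (m + 1)) =
        (m + 1) * ((m + 3) * (n + 1) + 2) := by ring
    rw [this, hd_even, mul_one]
    simp only [Nat.odd_add, Nat.even_add, Nat.even_mul] at hpar ⊢
    grind
  · have hRinv : R⁻¹ ^ (n + 1) = R := by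
      rw [inv_pow, inv_eq_iff_mul_eq_one, ← pow_succ, hR]
    rw [hb_pow, ha_pow, hRinv, ← mul_assoc, ← (hRd.pow_right _).eq, mul_assoc, ← pow_add]
    have : (m + 2) * (m * (n + 1)) + (n + 1) = (m + 1) * ((m + 1) * (n + 1)) := by ring
    rw [this, hd_even, mul_one]
    simp only [Nat.odd_add, Nat.even_add, Nat.even_mul] at hpar ⊢
    grind

lemma finRotate_eq_mk {n : ℕ} (i : Fin n) :
    finRotate n i = ⟨if i.1 + 1 = n then 0 else i.1 + 1, by grind⟩ := by
  obtain _ | n := n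
  · exact i.elim0
  · ext
    rw [coe_finRotate]
    simp [Fin.ext_iff]

lemma finRotate_pow_self (n : ℕ) : finRotate n ^ n = 1 := by
  obtain _ | _ | n := n
  · rfl
  · exact Subsingleton.elim (α := Perm (Fin 1)) _ _
  · refine orderOf_dvd_iff_pow_eq_one.mp ?_
    rw [← Perm.lcm_cycleType, cycleType_finRotate]
    simp

lemma swap_mul_finRotate_pow {n : ℕ} (hn : 2 ≤ n) :
    (swap (⟨0, by omega⟩ : Fin n) ⟨1, by omega⟩ * finRotate n) ^ (n - 1) = 1 := by
  set f := swap (⟨0, by omega⟩ : Fin n) ⟨1, by omega⟩ * finRotate n with hf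
  have happly (i : Fin n) : f i = ⟨if i.1 = 0 then 0 else if i.1 + 1 = n then 1 else i.1 + 1,
      by grind⟩ := by
    simp only [hf, Perm.mul_apply, finRotate_eq_mk, swap_apply_def, Fin.ext_iff]
    grind
  have hpow (k : ℕ) (hk : k + 1 < n) : (f ^ k) ⟨1, by omega⟩ = ⟨k + 1, hk⟩ := by
    induction k with
    | zero => rfl
    | succ k ih =>
      rw [pow_succ', Perm.mul_apply, ih (by omega), happly]
      grind
  have hlast : (f ^ (n - 1)) ⟨1, by omega⟩ = ⟨1, by omega⟩ := by
    rw [show n - 1 = n - 2 + 1 by omega, pow_succ', Perm.mul_apply, hpow _ (by omega), happly]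
    grind
  ext i
  obtain ⟨i, hi⟩ := i
  obtain _ | k := i
  · rw [Perm.pow_apply_eq_self_of_apply_eq_self]
    · rfl
    · simp [happly]
  · rw [← hpow k hi, ← Perm.mul_apply, ← pow_add, add_comm, pow_add, Perm.mul_apply, hlast,
      Perm.one_apply]

/-- A permutation of `Fin n` acting on the column `j` of `Fin n × Fin m`. -/
def colHom (n : ℕ) {m : ℕ} (j : Fin m) : Perm (Fin n) →* Perm (Fin n × Fin m) where
  toFun σ :=
    { toFun := fun x => (if x.2 = j then σ x.1 else x.1, x.2)
      invFun := fun x => (if x.2 = j then σ⁻¹ x.1 else x.1, x.2)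
      left_inv := fun x => by ext <;> by_cases h : x.2 = j <;> simp [h]
      right_inv := fun x => by ext <;> by_cases h : x.2 = j <;> simp [h] }
  map_one' := by ext x <;> simp
  map_mul' σ τ := by
    ext x
    · by_cases h : x.2 = j <;> simp [h]
    · rfl

lemma colHom_apply {n m : ℕ} (j : Fin m) (σ : Perm (Fin n)) (x : Fin n × Fin m) :
    colHom n j σ x = (if x.2 = j then σ x.1 else x.1, x.2) := rfl

lemma commute_colHom {n m : ℕ} {j k : Fin m} (h : j ≠ k) (σ τ : Perm (Fin n)) :
    Commute (colHom n j σ) (colHom n k τ) := by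
  ext x
  · simp only [Perm.mul_apply, colHom_apply]
    grind
  · rfl

section Columns

variable {n m : ℕ} (hn : 2 ≤ n) (hm : 2 ≤ m)

lemma piP_eq_colHom : piP n m hn hm =
    colHom n ⟨0, by omega⟩ (swap ⟨0, by omega⟩ ⟨1, by omega⟩) := by
  ext ⟨i, j⟩ <;> simp only [piP, colHom_apply, swap_apply_def, Prod.ext_iff] <;> grind

lemma rhoP_eq_colHom : rhoP n m hn hm = colHom n ⟨0, by omega⟩ (finRotate n) := by
  ext ⟨i, j⟩
  · by_cases h : j = ⟨0, by omega⟩ <;> simp [rhoP, colHom_apply, h]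
  · simp [rhoP, colHom_apply]

lemma pibarP_mul_self : pibarP n m hn hm * pibarP n m hn hm = 1 := by
  ext x <;> simp [pibarP]

lemma pibarP_mul_colHom_mul (σ : Perm (Fin n)) :
    pibarP n m hn hm * colHom n ⟨0, by omega⟩ σ * pibarP n m hn hm =
      colHom n ⟨1, by omega⟩ σ := by
  ext ⟨i, j⟩ <;>
    simp only [pibarP, Perm.mul_apply, colHom_apply, prodCongr_apply, Prod.map, coe_refl, id,
      swap_apply_def, Fin.ext_iff] <;> grind

lemma xi2_eq_mul : xi2 n m hn hm = pibarP n m hn hm * rhoP n m hn hm := by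
  ext ⟨i, j⟩ <;> simp [xi2, pibarP, rhoP]

lemma xi2_pow : xi2 n m hn hm ^ (2 * n) = 1 := by
  have : xi2 n m hn hm ^ 2 =
      colHom n ⟨1, by omega⟩ (finRotate n) * colHom n ⟨0, by omega⟩ (finRotate n) := by
    rw [← pibarP_mul_colHom_mul hn hm, xi2_eq_mul, rhoP_eq_colHom, sq]
    simp only [mul_assoc]
  rw [pow_mul, this, (commute_colHom (by simp) _ _).mul_pow, ← map_pow, ← map_pow,
    finRotate_pow_self, map_one, map_one, one_mul]

lemma xi1_eq_mul (hpar : Odd m ∨ Odd n) : xi1 n m hn hm =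
    rhobarP n m * colHom n ⟨1, by omega⟩ (swap ⟨0, by omega⟩ ⟨1, by omega⟩) := by
  have : ¬(Even m ∧ Even n) := by grind
  ext ⟨i, j⟩
  · by_cases h : j = ⟨1, by omega⟩ <;> simp [xi1, rhobarP, colHom_apply, h]
  · simp [xi1, rhobarP, colHom_apply, sbar, this]

lemma xi1_apply (hpar : Odd m ∨ Odd n) (i : Fin n) (j : Fin m) : xi1 n m hn hm (i, j) =
    (if j.1 = 1 then swap ⟨0, by omega⟩ ⟨1, by omega⟩ i else i,
      ⟨if j.1 + 1 = m then 0 else j.1 + 1, by grind⟩) := by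
  rw [xi1_eq_mul hn hm hpar, Perm.mul_apply, colHom_apply, rhobarP, prodCongr_apply, Prod.map,
    finRotate_eq_mk]
  simp [Fin.ext_iff]

lemma xi1_pow_apply_zero (hpar : Odd m ∨ Odd n) (i : Fin n) (k : ℕ) (hk : k < m) :
    (xi1 n m hn hm ^ k) (i, ⟨0, by omega⟩) =
      (if 2 ≤ k then swap ⟨0, by omega⟩ ⟨1, by omega⟩ i else i, ⟨k, hk⟩) := by
  induction k with
  | zero => rfl
  | succ k ih =>
    rw [pow_succ', Perm.mul_apply, ih (by omega), xi1_apply hn hm hpar]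
    grind

lemma xi1_pow_apply (hpar : Odd m ∨ Odd n) (i : Fin n) (j : Fin m) :
    (xi1 n m hn hm ^ m) (i, j) = (swap ⟨0, by omega⟩ ⟨1, by omega⟩ i, j) := by
  have hzero (i : Fin n) : (xi1 n m hn hm ^ m) (i, ⟨0, by omega⟩) =
      (swap ⟨0, by omega⟩ ⟨1, by omega⟩ i, ⟨0, by omega⟩) := by
    conv_lhs => rw [show xi1 n m hn hm ^ m = xi1 n m hn hm ^ (m - 1 + 1) by
      rw [Nat.sub_add_cancel (by omega)]]
    rw [pow_succ', Perm.mul_apply, xi1_pow_apply_zero hn hm hpar _ _ (by omega),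
      xi1_apply hn hm hpar]
    grind
  have hj := fun i => xi1_pow_apply_zero hn hm hpar i j.1 j.2
  have hij : (i, j) = (xi1 n m hn hm ^ j.1)
      (if 2 ≤ j.1 then swap ⟨0, by omega⟩ ⟨1, by omega⟩ i else i, ⟨0, by omega⟩) := by
    rw [hj]
    split_ifs <;> simp
  rw [hij, ← Perm.mul_apply, ← pow_add, add_comm, pow_add, Perm.mul_apply, hzero, hj]
  split_ifs <;> simp

lemma pibarP_mul_xi1_apply (hpar : Odd m ∨ Odd n) (i : Fin n) (j : Fin m) :
    (pibarP n m hn hm * xi1 n m hn hm) (i, j) =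
      (if j.1 = 1 then swap ⟨0, by omega⟩ ⟨1, by omega⟩ i else i,
        ⟨if j.1 = 0 then 0 else if j.1 + 1 = m then 1 else j.1 + 1, by grind⟩) := by
  rw [Perm.mul_apply, xi1_apply hn hm hpar]
  simp only [pibarP, prodCongr_apply, Prod.map, coe_refl, id, swap_apply_def, Fin.ext_iff]
  grind

lemma pibarP_mul_xi1_pow_apply_one (hpar : Odd m ∨ Odd n) (i : Fin n) (k : ℕ) (hk : k + 1 < m) :
    ((pibarP n m hn hm * xi1 n m hn hm) ^ k) (i, ⟨1, by omega⟩) =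
      (if 1 ≤ k then swap ⟨0, by omega⟩ ⟨1, by omega⟩ i else i, ⟨k + 1, hk⟩) := by
  induction k with
  | zero => rfl
  | succ k ih =>
    rw [pow_succ', Perm.mul_apply, ih (by omega), pibarP_mul_xi1_apply hn hm hpar]
    grind

lemma pibarP_mul_xi1_pow_apply (hpar : Odd m ∨ Odd n) (i : Fin n) (j : Fin m) :
    ((pibarP n m hn hm * xi1 n m hn hm) ^ (m - 1)) (i, j) =
      (if j.1 = 0 then i else swap ⟨0, by omega⟩ ⟨1, by omega⟩ i, j) := by
  set d := pibarP n m hn hm * xi1 n m hn hm with hd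
  have hone (i : Fin n) : (d ^ (m - 1)) (i, ⟨1, by omega⟩) =
      (swap ⟨0, by omega⟩ ⟨1, by omega⟩ i, ⟨1, by omega⟩) := by
    rw [show m - 1 = m - 2 + 1 by omega, pow_succ', Perm.mul_apply,
      pibarP_mul_xi1_pow_apply_one hn hm hpar _ _ (by omega), pibarP_mul_xi1_apply hn hm hpar]
    grind
  obtain ⟨j, hj⟩ := j
  obtain _ | k := j
  · rw [Perm.pow_apply_eq_self_of_apply_eq_self]
    · simp
    · simp [hd, pibarP_mul_xi1_apply hn hm hpar]
  · have hk := fun i => pibarP_mul_xi1_pow_apply_one hn hm hpar i k hj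
    rw [← hd] at hk
    have hij : (i, ⟨k + 1, hj⟩) = (d ^ k)
        (if 1 ≤ k then swap ⟨0, by omega⟩ ⟨1, by omega⟩ i else i, ⟨1, by omega⟩) := by
      rw [hk]
      split_ifs <;> simp
    rw [hij, ← Perm.mul_apply, ← pow_add, add_comm, pow_add, Perm.mul_apply, hone, hk]
    split_ifs <;> simp_all

lemma commute_colHom_pibarP_mul_xi1 (hpar : Odd m ∨ Odd n) (σ : Perm (Fin n)) :
    Commute (colHom n ⟨0, by omega⟩ σ) (pibarP n m hn hm * xi1 n m hn hm) := by
  refine Equiv.ext fun ⟨i, j⟩ => ?_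
  rw [Perm.mul_apply, Perm.mul_apply _ (colHom n _ σ), colHom_apply, colHom_apply,
    pibarP_mul_xi1_apply hn hm hpar, pibarP_mul_xi1_apply hn hm hpar]
  simp only [Fin.ext_iff]
  grind

lemma xi1_pow_eq_mul (hpar : Odd m ∨ Odd n) : xi1 n m hn hm ^ m =
    piP n m hn hm * (pibarP n m hn hm * xi1 n m hn hm) ^ (m - 1) := by
  refine Equiv.ext fun ⟨i, j⟩ => ?_
  rw [Perm.mul_apply, xi1_pow_apply hn hm hpar, pibarP_mul_xi1_pow_apply hn hm hpar,
    piP_eq_colHom, colHom_apply]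
  simp only [Fin.ext_iff]
  grind

lemma rhobarP_eq_mul (hpar : Odd m ∨ Odd n) : rhobarP n m =
    xi1 n m hn hm ^ 2 * piP n m hn hm * (xi1 n m hn hm)⁻¹ := by
  rw [eq_mul_inv_iff_mul_eq]
  refine Equiv.ext fun ⟨i, j⟩ => ?_
  rw [sq, piP_eq_colHom, Perm.mul_apply, Perm.mul_apply, Perm.mul_apply, colHom_apply,
    xi1_apply hn hm hpar, xi1_apply hn hm hpar, xi1_apply hn hm hpar]
  simp only [rhobarP, prodCongr_apply, Prod.map, coe_refl, id, finRotate_eq_mk, Fin.ext_iff]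
  grind [swap_apply_self]

end Columns

/-- The identities expressing `π, ρ, π̄, ρ̄` as words in `ξ1, ξ2` when `m` or `n` is odd.
Products in the paper are left-to-right; here `*` is right-to-left composition of
permutations, so each word is reversed. -/
theorem stmt17 (n m : ℕ) (hn : 2 ≤ n) (hm : 2 ≤ m) (hpar : Odd m ∨ Odd n) :
    piP n m hn hm =
        xi1 n m hn hm ^ m *
          (xi2 n m hn hm ^ (2 * n - 1) * xi1 n m hn hm ^ (m + 1)) ^ ((m - 1) * (n - 1)) *
            (xi2 n m hn hm ^ (2 * n - 1) * xi1 n m hn hm) ^ ((m - 1) * n) ∧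
      rhoP n m hn hm =
        (xi2 n m hn hm ^ (2 * n - 1) * xi1 n m hn hm ^ (m + 1)) ^ ((m - 2) * (n - 1)) *
          (xi2 n m hn hm ^ (2 * n - 1) * xi1 n m hn hm) ^ (n - 1) ∧
      pibarP n m hn hm =
        (xi2 n m hn hm ^ (2 * n - 1) * xi1 n m hn hm ^ (m + 1)) ^ ((m - 2) * (n - 1)) *
          (xi2 n m hn hm ^ (2 * n - 1) * xi1 n m hn hm) ^ n * xi1 n m hn hm ^ (2 * m - 1) ∧
      rhobarP n m =
        xi1 n m hn hm ^ (m + 2) *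
          (xi2 n m hn hm ^ (2 * n - 1) * xi1 n m hn hm ^ (m + 1)) ^ ((m - 1) * (n - 1)) *
            (xi2 n m hn hm ^ (2 * n - 1) * xi1 n m hn hm) ^ ((m - 1) * n) *
              xi1 n m hn hm ^ (2 * m - 1) := by
  have hxi1 : xi1 n m hn hm ^ (2 * m) = 1 := by
    ext ⟨i, j⟩ <;> simp [two_mul, pow_add, xi1_pow_apply hn hm hpar]
  have hinv1 : xi1 n m hn hm ^ (2 * m - 1) = (xi1 n m hn hm)⁻¹ := by
    rw [eq_inv_iff_mul_eq_one, ← pow_succ, Nat.sub_add_cancel (by omega), hxi1]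
  have hinv2 : xi2 n m hn hm ^ (2 * n - 1) = (rhoP n m hn hm)⁻¹ * pibarP n m hn hm := by
    rw [← inv_eq_of_mul_eq_one_right (pibarP_mul_self hn hm), ← mul_inv_rev, ← xi2_eq_mul,
      eq_inv_iff_mul_eq_one, ← pow_succ, Nat.sub_add_cancel (by omega), xi2_pow]
  have hd : ((pibarP n m hn hm * xi1 n m hn hm) ^ (m - 1)) ^ 2 = 1 := by
    refine Equiv.ext fun ⟨i, j⟩ => ?_
    rw [sq, Perm.mul_apply, pibarP_mul_xi1_pow_apply hn hm hpar,
      pibarP_mul_xi1_pow_apply hn hm hpar]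
    split_ifs <;> simp
  have hR : rhoP n m hn hm ^ n = 1 := by
    rw [rhoP_eq_colHom, ← map_pow, finRotate_pow_self, map_one]
  have hRP : ((rhoP n m hn hm)⁻¹ * piP n m hn hm) ^ (n - 1) = 1 := by
    rw [rhoP_eq_colHom, piP_eq_colHom, ← map_inv, ← map_mul, ← map_pow, ← inv_inj, ← map_inv,
      ← inv_pow, mul_inv_rev, inv_inv, swap_inv, swap_mul_finRotate_pow hn, map_one, inv_one]
  obtain ⟨hpi, hrho⟩ := words_eq_of_commute hn hm hpar hR hRP hd
    (piP_eq_colHom hn hm ▸ commute_colHom_pibarP_mul_xi1 hn hm hpar _)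
    (rhoP_eq_colHom hn hm ▸ commute_colHom_pibarP_mul_xi1 hn hm hpar _)
  rw [← xi1_pow_eq_mul hn hm hpar] at hpi hrho
  have ha : xi2 n m hn hm ^ (2 * n - 1) * xi1 n m hn hm =
      (rhoP n m hn hm)⁻¹ * (pibarP n m hn hm * xi1 n m hn hm) := by
    rw [hinv2, mul_assoc]
  rw [pow_succ' _ m, ← mul_assoc (xi2 n m hn hm ^ (2 * n - 1)), ha, hinv1]
  refine ⟨hpi.symm, hrho.symm, ?_, ?_⟩
  · rw [← pow_sub_one_mul (show n ≠ 0 by omega), ← mul_assoc, hrho, mul_inv_cancel_left,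
      mul_inv_cancel_right]
  · rw [add_comm m 2, pow_add, mul_assoc (_ ^ 2), mul_assoc (_ ^ 2), hpi]
    exact rhobarP_eq_mul hn hm hpar
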